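/- Fix β > 0 and let F : ℕ → [0,∞) satisfy F(N)/N → F₀ as N → ∞ for some constant 0 ≤ F₀ < 4β. For each N ≥ 2 let λ(N) be the unique real number with Σ_{k=1}^N m(λ(N) + k·F(N)) = 1, write λ_k = λ(N) + k·F(N), let σ_N² = Σ_{k=1}^N v(λ_k), and define the normalized Lyapunov ratio L_N = ( Σ_{k=1}^N (1/c(λ_k))·∫₀¹ |x − m(λ_k)|³·e^{−λ_k x − β/x} dx ) / σ_N³. Then there exist a constant C > 0 and N₀ ∈ ℕ such that L_N ≤ C·N^{−1/2} for all N ≥ N₀. -/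

import Mathlib

open MeasureTheory Filter

noncomputable section

/-- Normalizing constant `c(λ) = ∫₀¹ e^{−λx − β/x} dx`. -/
def cpart (β l : ℝ) : ℝ := ∫ x in (0:ℝ)..1, Real.exp (-(l * x) - β / x)

/-- Single-particle mean `m(λ)`. -/
def mpart (β l : ℝ) : ℝ :=
  (∫ x in (0:ℝ)..1, x * Real.exp (-(l * x) - β / x)) / cpart β l

/-- Single-particle variance `v(λ)`. -/
def vpart (β l : ℝ) : ℝ :=
  (∫ x in (0:ℝ)..1, x ^ 2 * Real.exp (-(l * x) - β / x)) / cpart β l - mpart β l ^ 2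


/-- Boltzmann weight. -/
def wgt (β l x : ℝ) : ℝ := Real.exp (-(l * x) - β / x)

/-- Expectation. -/
def EE (β l : ℝ) (f : ℝ → ℝ) : ℝ := (∫ x in (0:ℝ)..1, f x * wgt β l x) / cpart β l

/-- Boundary term. -/
def dlt (β l : ℝ) : ℝ := Real.exp (-l - β) / cpart β l

lemma wgt_pos (β l x : ℝ) : 0 < wgt β l x := Real.exp_pos _

lemma wgt_le {β : ℝ} (hβ : 0 < β) (l : ℝ) {x : ℝ} (hx : x ∈ Set.Icc (0:ℝ) 1) :
    wgt β l x ≤ Real.exp |l| := by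
  unfold wgt
  apply Real.exp_le_exp.2
  have h1 : 0 ≤ β / x := div_nonneg hβ.le hx.1
  have h2 : -(l * x) ≤ |l| := by
    have : |l * x| ≤ |l| := by
      rw [abs_mul, abs_of_nonneg hx.1]
      exact mul_le_of_le_one_right (abs_nonneg _) hx.2
    exact (neg_le_abs _).trans this
  linarith

lemma wgt_int {β : ℝ} (hβ : 0 < β) (l : ℝ) :
    IntervalIntegrable (wgt β l) volume 0 1 := by
  rw [intervalIntegrable_iff_integrableOn_Icc_of_le zero_le_one]
  refine Measure.integrableOn_of_bounded (M := Real.exp |l|) (by simp) ?_ ?_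
  · unfold wgt
    exact (by fun_prop : Measurable fun x => Real.exp (-(l * x) - β / x)).aestronglyMeasurable
  · filter_upwards [ae_restrict_mem measurableSet_Icc] with x hx
    rw [Real.norm_eq_abs, abs_of_pos (wgt_pos _ _ _)]
    exact wgt_le hβ l hx

lemma mul_wgt_int {β : ℝ} (hβ : 0 < β) (l : ℝ) {f : ℝ → ℝ} (hf : Continuous f) :
    IntervalIntegrable (fun x => f x * wgt β l x) volume 0 1 :=
  (wgt_int hβ l).continuousOn_mul hf.continuousOn

lemma cpart_pos {β : ℝ} (hβ : 0 < β) (l : ℝ) : 0 < cpart β l := by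
  unfold cpart
  exact intervalIntegral.intervalIntegral_pos_of_pos_on (wgt_int hβ l)
    (fun x _ => Real.exp_pos _) one_pos

lemma EE_mono {β : ℝ} (hβ : 0 < β) (l : ℝ) {f g : ℝ → ℝ} (hf : Continuous f) (hg : Continuous g)
    (h : ∀ x, 0 ≤ x → x ≤ 1 → f x ≤ g x) : EE β l f ≤ EE β l g := by
  unfold EE
  apply div_le_div_of_nonneg_right _ (cpart_pos hβ l).le
  apply intervalIntegral.integral_mono_on zero_le_one (mul_wgt_int hβ l hf) (mul_wgt_int hβ l hg)
  intro x hx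
  exact mul_le_mul_of_nonneg_right (h x hx.1 hx.2) (wgt_pos _ _ _).le

lemma EE_add {β : ℝ} (hβ : 0 < β) (l : ℝ) {f g : ℝ → ℝ} (hf : Continuous f) (hg : Continuous g) :
    EE β l (fun x => f x + g x) = EE β l f + EE β l g := by
  unfold EE
  rw [← add_div, ← intervalIntegral.integral_add (mul_wgt_int hβ l hf) (mul_wgt_int hβ l hg)]
  simp only [add_mul]

lemma EE_sub {β : ℝ} (hβ : 0 < β) (l : ℝ) {f g : ℝ → ℝ} (hf : Continuous f) (hg : Continuous g) :
    EE β l (fun x => f x - g x) = EE β l f - EE β l g := by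
  unfold EE
  rw [← sub_div, ← intervalIntegral.integral_sub (mul_wgt_int hβ l hf) (mul_wgt_int hβ l hg)]
  simp only [sub_mul]

lemma EE_smul (β l a : ℝ) (f : ℝ → ℝ) :
    EE β l (fun x => a * f x) = a * EE β l f := by
  unfold EE
  simp only [mul_assoc]
  rw [intervalIntegral.integral_const_mul, mul_div_assoc]

lemma EE_one {β : ℝ} (hβ : 0 < β) (l : ℝ) : EE β l (fun _ => 1) = 1 := by
  unfold EE
  simp only [one_mul]
  exact div_self (cpart_pos hβ l).ne'

lemma EE_const {β : ℝ} (hβ : 0 < β) (l a : ℝ) : EE β l (fun _ => a) = a := by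
  have := EE_smul β l a (fun _ => 1)
  rw [EE_one hβ] at this
  simpa using this

lemma EE_nonneg {β : ℝ} (hβ : 0 < β) (l : ℝ) {f : ℝ → ℝ} (hf : Continuous f)
    (h : ∀ x, 0 ≤ x → x ≤ 1 → 0 ≤ f x) : 0 ≤ EE β l f := by
  have := EE_mono hβ l continuous_const hf h
  rwa [EE_const hβ] at this

lemma mpart_eq (β l : ℝ) : mpart β l = EE β l (fun x => x) := rfl

lemma vpart_eq (β l : ℝ) : vpart β l = EE β l (fun x => x ^ 2) - mpart β l ^ 2 := rfl

/-- Quadratic expectation around a point. -/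
lemma EE_sq {β : ℝ} (hβ : 0 < β) (l a : ℝ) :
    EE β l (fun x => (x - a) ^ 2) = vpart β l + (mpart β l - a) ^ 2 := by
  have h : (fun x : ℝ => (x - a) ^ 2) = fun x => (x ^ 2 - (2 * a) * x) + a ^ 2 := by
    funext x; ring
  rw [h, EE_add hβ l (by fun_prop) (by fun_prop), EE_sub hβ l (by fun_prop) (by fun_prop),
    EE_smul, EE_const hβ, vpart_eq, mpart_eq]
  ring

lemma stein {β : ℝ} (hβ : 0 < β) (l : ℝ) {h h' : ℝ → ℝ} (hd : ∀ x, HasDerivAt h (h' x) x)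
    (hc : Continuous h') :
    EE β l (fun x => (l * x ^ 2 - β) * h x) =
      EE β l (fun x => x ^ 2 * h' x + 2 * x * h x) - h 1 * dlt β l := by
  have hch : Continuous h := continuous_iff_continuousAt.2 fun x => (hd x).continuousAt
  have key : ∫ x in (0:ℝ)..1, ((x ^ 2 * h' x + 2 * x * h x) - (l * x ^ 2 - β) * h x) * wgt β l x
      = h 1 * Real.exp (-l - β) := by
    have := intervalIntegral.integral_eq_sub_of_hasDerivAt_of_le (a := (0:ℝ)) (b := 1)
      (f := fun x => x ^ 2 * h x * wgt β l x)
      (f' := fun x => ((x ^ 2 * h' x + 2 * x * h x) - (l * x ^ 2 - β) * h x) * wgt β l x)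
      zero_le_one ?_ ?_ (mul_wgt_int hβ l (by fun_prop))
    · rw [this]; simp [wgt]
    · intro x hx
      rcases eq_or_lt_of_le hx.1 with h0 | h0
      · subst h0
        have hz : ((0:ℝ) ^ 2 * h 0 * wgt β l 0) = 0 := by simp
        unfold ContinuousWithinAt
        simp only [hz]
        apply squeeze_zero_norm' (a := fun x : ℝ => |x ^ 2 * h x| * Real.exp |l|)
        · filter_upwards [self_mem_nhdsWithin] with y hy
          rw [Real.norm_eq_abs, abs_mul, abs_of_pos (wgt_pos β l y)]
          exact mul_le_mul_of_nonneg_left (wgt_le hβ l hy) (abs_nonneg _)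
        · have : Continuous (fun x : ℝ => |x ^ 2 * h x| * Real.exp |l|) := by fun_prop
          have := this.tendsto 0
          simp only [ne_eq, OfNat.ofNat_ne_zero, not_false_eq_true, zero_pow, zero_mul, abs_zero] at this
          exact this.mono_left nhdsWithin_le_nhds
      · apply ContinuousAt.continuousWithinAt
        unfold wgt
        have : ContinuousAt (fun x => β / x) x := continuousAt_const.div continuousAt_id h0.ne'
        have := hch.continuousAt (x := x)
        fun_prop
    · intro x hx
      have h0 : x ≠ 0 := hx.1.ne'
      have hw : HasDerivAt (wgt β l) (wgt β l x * (-(l * 1) - (0 * x - β * 1) / x ^ 2)) x := by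
        unfold wgt
        exact (((hasDerivAt_id x).const_mul l).neg.sub
          ((hasDerivAt_const x β).div (hasDerivAt_id x) h0)).exp
      have := (((hasDerivAt_pow 2 x).mul (hd x)).mul hw)
      refine this.congr_deriv ?_
      simp only [Pi.mul_apply]
      field_simp
      push_cast
      ring
  have e := EE_sub hβ l (f := fun x => x ^ 2 * h' x + 2 * x * h x)
    (g := fun x => (l * x ^ 2 - β) * h x) (by fun_prop) (by fun_prop)
  have e2 : EE β l (fun x => (x ^ 2 * h' x + 2 * x * h x) - (l * x ^ 2 - β) * h x)
      = h 1 * dlt β l := by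
    unfold EE dlt
    rw [key, mul_div_assoc]
  linarith

lemma mpart_anti {β : ℝ} (hβ : 0 < β) {l μ : ℝ} (h : l ≤ μ) : mpart β μ ≤ mpart β l := by
  set m := mpart β l with hm
  have h0 : EE β l (fun x => x - m) = 0 := by
    rw [EE_sub hβ l (by fun_prop) (by fun_prop), EE_const hβ, ← mpart_eq]; ring
  have h1 : EE β l (fun x => (x - m) * Real.exp (-((μ - l) * x))) ≤
      EE β l (fun x => Real.exp (-((μ - l) * m)) * (x - m)) := by
    apply EE_mono hβ l (by fun_prop) (by fun_prop)
    intro x _ _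
    have : 0 ≤ μ - l := by linarith
    rcases le_total x m with hx | hx
    · have : Real.exp (-((μ - l) * m)) ≤ Real.exp (-((μ - l) * x)) := by
        apply Real.exp_le_exp.2; nlinarith
      nlinarith
    · have : Real.exp (-((μ - l) * x)) ≤ Real.exp (-((μ - l) * m)) := by
        apply Real.exp_le_exp.2; nlinarith
      nlinarith
  rw [EE_smul, h0, mul_zero] at h1
  have h2 : EE β μ (fun x => x - m) ≤ 0 := by
    unfold EE at h1 ⊢
    have e : ∀ x, (x - m) * Real.exp (-((μ - l) * x)) * wgt β l x = (x - m) * wgt β μ x := by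
      intro x
      unfold wgt
      rw [mul_assoc, ← Real.exp_add]
      congr 2; ring
    simp only [e] at h1
    rw [div_le_iff₀ (cpart_pos hβ l), zero_mul] at h1
    exact div_nonpos_of_nonpos_of_nonneg h1 (cpart_pos hβ μ).le
  rw [EE_sub hβ μ (by fun_prop) (by fun_prop), EE_const hβ, ← mpart_eq] at h2
  linarith

lemma dlt_nonneg {β : ℝ} (hβ : 0 < β) (l : ℝ) : 0 ≤ dlt β l :=
  div_nonneg (Real.exp_pos _).le (cpart_pos hβ l).le

lemma mom_nonneg {β : ℝ} (hβ : 0 < β) (l : ℝ) (n : ℕ) : 0 ≤ EE β l (fun x => x ^ n) :=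
  EE_nonneg hβ l (by fun_prop) (fun x hx _ => pow_nonneg hx n)

lemma mom_rec {β : ℝ} (hβ : 0 < β) (l : ℝ) (n : ℕ) :
    l * EE β l (fun x => x ^ (n + 2)) = β * EE β l (fun x => x ^ n)
      + (n + 2) * EE β l (fun x => x ^ (n + 1)) - dlt β l := by
  have h := stein hβ l (h := fun x => x ^ n) (h' := fun x => (n : ℝ) * x ^ (n - 1))
    (fun x => hasDerivAt_pow n x) (by fun_prop)
  have e1 : (fun x : ℝ => (l * x ^ 2 - β) * x ^ n) = fun x => l * x ^ (n + 2) - β * x ^ n := by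
    funext x; ring
  have e2 : (fun x : ℝ => x ^ 2 * ((n : ℝ) * x ^ (n - 1)) + 2 * x * x ^ n)
      = fun x => ((n : ℝ) + 2) * x ^ (n + 1) := by
    funext x
    rcases n with _ | k
    · simp
    · simp only [Nat.add_sub_cancel]; push_cast; ring
  simp only [e1, e2, one_pow, one_mul] at h
  rw [EE_sub hβ l (by fun_prop) (by fun_prop), EE_smul, EE_smul, EE_smul] at h
  linarith

lemma vpart_nonneg {β : ℝ} (hβ : 0 < β) (l : ℝ) : 0 ≤ vpart β l := by
  have h := EE_sq hβ l (mpart β l)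
  have : 0 ≤ EE β l (fun x => (x - mpart β l) ^ 2) :=
    EE_nonneg hβ l (by fun_prop) (fun x _ _ => sq_nonneg _)
  simp at h
  linarith

lemma mom_step {β : ℝ} (hβ : 0 < β) {l s : ℝ} (hs : 0 < s) (hl : l * s ^ 2 = β) (hls : 2 ≤ l * s)
    (n : ℕ) : EE β l (fun x => x ^ (n + 2)) ≤ s ^ 2 * EE β l (fun x => x ^ n)
      + (n + 2) / 2 * s * EE β l (fun x => x ^ (n + 1)) := by
  have h := mom_rec hβ l n
  have hd := dlt_nonneg hβ l
  have h1 := mom_nonneg hβ l (n + 1)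
  have hl0 : 0 < l := by
    by_contra hc
    nlinarith
  have h3 : 0 ≤ ((n : ℝ) + 2) / 2 * EE β l (fun x => x ^ (n + 1)) := by positivity
  have h4 := mul_le_mul_of_nonneg_right hls h3
  refine le_of_mul_le_mul_left ?_ hl0
  rw [h]
  have e : l * (s ^ 2 * EE β l (fun x => x ^ n)) = β * EE β l (fun x => x ^ n) := by rw [← hl]; ring
  rw [mul_add, e]
  nlinarith

lemma mom_bounds {β : ℝ} (hβ : 0 < β) {l s : ℝ} (hs : 0 < s) (hl : l * s ^ 2 = β)
    (hls : 2 ≤ l * s) :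
    mpart β l ≤ 2 * s ∧ EE β l (fun x => x ^ 3) ≤ 7 * s ^ 3 ∧
      EE β l (fun x => x ^ 6) ≤ 200 * s ^ 6 := by
  have h0 : EE β l (fun x => x ^ 0) = 1 := by simpa using EE_one hβ l
  have e1 : EE β l (fun x => x ^ 1) = mpart β l := by simp [mpart_eq]
  have h2 := mom_step hβ hs hl hls 0
  have h3 := mom_step hβ hs hl hls 1
  have h4 := mom_step hβ hs hl hls 2
  have h5 := mom_step hβ hs hl hls 3
  have h6 := mom_step hβ hs hl hls 4
  norm_num only [zero_add, h0, e1] at h2 h3 h4 h5 h6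
  have hv := vpart_nonneg hβ l
  rw [vpart_eq] at hv
  set m := mpart β l
  set m2 := EE β l (fun x => x ^ 2)
  set m3 := EE β l (fun x => x ^ 3)
  set m4 := EE β l (fun x => x ^ 4)
  set m5 := EE β l (fun x => x ^ 5)
  set m6 := EE β l (fun x => x ^ 6)
  have hm : m ≤ 2 * s := by
    by_contra hc
    push Not at hc
    nlinarith
  have s2 : 0 ≤ s ^ 2 := by positivity
  have b2 : m2 ≤ 3 * s ^ 2 := by nlinarith
  have b3 : m3 ≤ 7 * s ^ 3 := by
    have := mul_le_mul_of_nonneg_left hm s2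
    have := mul_le_mul_of_nonneg_left b2 hs.le
    nlinarith [pow_pos hs 3]
  have b4 : m4 ≤ 17 * s ^ 4 := by
    have := mul_le_mul_of_nonneg_left b2 s2
    have := mul_le_mul_of_nonneg_left b3 hs.le
    nlinarith [pow_pos hs 4]
  have b5 : m5 ≤ 50 * s ^ 5 := by
    have := mul_le_mul_of_nonneg_left b3 s2
    have := mul_le_mul_of_nonneg_left b4 hs.le
    nlinarith [pow_pos hs 5]
  have b6 : m6 ≤ 200 * s ^ 6 := by
    have := mul_le_mul_of_nonneg_left b4 s2
    have := mul_le_mul_of_nonneg_left b5 hs.le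
    nlinarith [pow_pos hs 6]
  exact ⟨hm, b3, b6⟩

/-- Stein identity in terms of `q = x^2 - s^2`, dropping the boundary term. -/
lemma stein_le {β : ℝ} (hβ : 0 < β) {l s : ℝ} (hl : l * s ^ 2 = β) {h h' : ℝ → ℝ}
    (hd : ∀ x, HasDerivAt h (h' x) x) (hc : Continuous h') (h1 : 0 ≤ h 1) :
    l * EE β l (fun x => (x ^ 2 - s ^ 2) * h x) ≤
      EE β l (fun x => x ^ 2 * h' x + 2 * x * h x) := by
  have h0 := stein hβ l hd hc
  have e : (fun x => (l * x ^ 2 - β) * h x) = fun x => l * ((x ^ 2 - s ^ 2) * h x) := by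
    funext x; rw [← hl]; ring
  rw [e, EE_smul] at h0
  nlinarith [mul_nonneg h1 (dlt_nonneg hβ l)]

lemma hasDerivAt_q (s x : ℝ) : HasDerivAt (fun x : ℝ => x ^ 2 - s ^ 2) (2 * x) x := by
  simpa using (hasDerivAt_pow 2 x).sub_const (s ^ 2)

lemma q2_bound {β : ℝ} (hβ : 0 < β) {l s : ℝ} (hs : 0 < s) (hs1 : s ≤ 1) (hl : l * s ^ 2 = β)
    (hls : 2 ≤ l * s) : l * EE β l (fun x => (x ^ 2 - s ^ 2) ^ 2) ≤ 28 * s ^ 3 := by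
  have h := stein_le hβ hl (hasDerivAt_q s) (by fun_prop) (by nlinarith)
  have h2 : EE β l (fun x => x ^ 2 * (2 * x) + 2 * x * (x ^ 2 - s ^ 2)) ≤
      EE β l (fun x => 4 * x ^ 3) := by
    apply EE_mono hβ l (by fun_prop) (by fun_prop)
    intro x hx _
    nlinarith [mul_nonneg hx (sq_nonneg s)]
  rw [EE_smul] at h2
  have h3 := (mom_bounds hβ hs hl hls).2.1
  simp only [← pow_two] at h
  linarith

lemma q4_bound {β : ℝ} (hβ : 0 < β) {l s : ℝ} (hs : 0 < s) (hs1 : s ≤ 1) (hl : l * s ^ 2 = β)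
    (hls : 2 ≤ l * s) : l ^ 2 * EE β l (fun x => (x ^ 2 - s ^ 2) ^ 4) ≤ 11200 * s ^ 6 := by
  have hl0 : 0 < l := by
    by_contra hc
    nlinarith
  have hq1 : 0 ≤ (1:ℝ) ^ 2 - s ^ 2 := by nlinarith
  have a1 := stein_le hβ hl (fun x => (hasDerivAt_q s x).pow 3) (by fun_prop)
    (by simp only [Pi.pow_apply]; positivity)
  have a2 : EE β l (fun x => x ^ 2 * ((3:ℕ) * (x ^ 2 - s ^ 2) ^ (3 - 1) * (2 * x))
      + 2 * x * (x ^ 2 - s ^ 2) ^ 3) ≤ EE β l (fun x => 8 * ((x ^ 2 - s ^ 2) * (x ^ 3 * (x ^ 2 - s ^ 2)))) := by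
    apply EE_mono hβ l (by fun_prop) (by fun_prop)
    intro x hx _
    have : 0 ≤ x * (x ^ 2 - s ^ 2) ^ 2 * s ^ 2 := by positivity
    push_cast
    nlinarith
  rw [EE_smul] at a2
  have b1 := stein_le hβ hl (fun x => (hasDerivAt_pow 3 x).mul (hasDerivAt_q s x)) (by fun_prop)
    (by simp only [Pi.mul_apply]; positivity)
  have b2 : EE β l (fun x => x ^ 2 * ((3:ℕ) * x ^ (3 - 1) * (x ^ 2 - s ^ 2) + x ^ 3 * (2 * x))
      + 2 * x * (x ^ 3 * (x ^ 2 - s ^ 2))) ≤ EE β l (fun x => 7 * x ^ 6) := by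
    apply EE_mono hβ l (by fun_prop) (by fun_prop)
    intro x hx _
    have : 0 ≤ x ^ 4 * s ^ 2 := by positivity
    push_cast
    nlinarith
  rw [EE_smul] at b2
  simp only [Pi.pow_apply, Pi.mul_apply] at a1 b1
  have h3 := (mom_bounds hβ hs hl hls).2.2
  have e : (fun x : ℝ => (x ^ 2 - s ^ 2) * (x ^ 2 - s ^ 2) ^ 3) = fun x => (x ^ 2 - s ^ 2) ^ 4 := by
    funext x; ring
  rw [e] at a1
  have c1 := mul_le_mul_of_nonneg_left (a1.trans a2) hl0.le
  have c2 := b1.trans b2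
  nlinarith

lemma z2_bound {β : ℝ} (hβ : 0 < β) {l s : ℝ} (hs : 0 < s) (hs1 : s ≤ 1) (hl : l * s ^ 2 = β)
    (hls : 2 ≤ l * s) : l * EE β l (fun x => (x - s) ^ 2) ≤ 28 * s := by
  have hl0 : 0 < l := by
    by_contra hc
    nlinarith
  have h := q2_bound hβ hs hs1 hl hls
  have h2 : EE β l (fun x => s ^ 2 * (x - s) ^ 2) ≤ EE β l (fun x => (x ^ 2 - s ^ 2) ^ 2) := by
    apply EE_mono hβ l (by fun_prop) (by fun_prop)
    intro x hx _
    have e : (x ^ 2 - s ^ 2) ^ 2 = (x + s) ^ 2 * (x - s) ^ 2 := by ring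
    rw [e]
    gcongr
    linarith
  rw [EE_smul] at h2
  have h3 := mul_le_mul_of_nonneg_left h2 hl0.le
  refine le_of_mul_le_mul_left ?_ (pow_pos hs 2)
  linarith

lemma z4_bound {β : ℝ} (hβ : 0 < β) {l s : ℝ} (hs : 0 < s) (hs1 : s ≤ 1) (hl : l * s ^ 2 = β)
    (hls : 2 ≤ l * s) : l ^ 2 * EE β l (fun x => (x - s) ^ 4) ≤ 11200 * s ^ 2 := by
  have h := q4_bound hβ hs hs1 hl hls
  have h2 : EE β l (fun x => s ^ 4 * (x - s) ^ 4) ≤ EE β l (fun x => (x ^ 2 - s ^ 2) ^ 4) := by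
    apply EE_mono hβ l (by fun_prop) (by fun_prop)
    intro x hx _
    have e : (x ^ 2 - s ^ 2) ^ 4 = (x + s) ^ 4 * (x - s) ^ 4 := by ring
    rw [e]
    gcongr
    linarith
  rw [EE_smul] at h2
  have h3 := mul_le_mul_of_nonneg_left h2 (sq_nonneg l)
  refine le_of_mul_le_mul_left ?_ (pow_pos hs 4)
  linarith

/-- Third absolute moment. -/
lemma third_bound {β : ℝ} (hβ : 0 < β) {l s T : ℝ} (hs : 0 < s) (hs1 : s ≤ 1)
    (hl : l * s ^ 2 = β) (hls : 2 ≤ l * s) (hT : 0 < T) (hsT : s ≤ l * T ^ 2) :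
    EE β l (fun x => |x - mpart β l| ^ 3) ≤ 100000 * T ^ 3 := by
  have hl0 : 0 < l := by
    by_contra hc
    nlinarith
  have h2 := z2_bound hβ hs hs1 hl hls
  have h4 := z4_bound hβ hs hs1 hl hls
  have k2 : EE β l (fun x => (x - s) ^ 2) ≤ 28 * T ^ 2 := by
    refine le_of_mul_le_mul_left ?_ hl0
    linarith
  have k4 : EE β l (fun x => (x - s) ^ 4) ≤ 11200 * T ^ 4 := by
    refine le_of_mul_le_mul_left ?_ (pow_pos hl0 2)
    have : s ^ 2 ≤ (l * T ^ 2) ^ 2 := by gcongr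
    linarith
  have hv := vpart_nonneg hβ l
  have hq := EE_sq hβ l s
  set m := mpart β l with hm
  have km : (m - s) ^ 2 ≤ 28 * T ^ 2 := by linarith
  have km4 : (m - s) ^ 4 ≤ 784 * T ^ 4 := by
    have : ((m - s) ^ 2) ^ 2 ≤ (28 * T ^ 2) ^ 2 := by gcongr
    nlinarith
  have hmono : EE β l (fun x => |x - m| ^ 3) ≤ EE β l (fun x =>
      (T * (x - s) ^ 2 + (4 / T) * (x - s) ^ 4) + (T * (m - s) ^ 2 + (4 / T) * (m - s) ^ 4)) := by
    apply EE_mono hβ l (by fun_prop) (by fun_prop)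
    intro x _ _
    have p1 : (x - m) ^ 2 ≤ 2 * (x - s) ^ 2 + 2 * (m - s) ^ 2 := by
      nlinarith [sq_nonneg ((x - s) + (m - s))]
    have p2 : (x - m) ^ 4 ≤ 8 * (x - s) ^ 4 + 8 * (m - s) ^ 4 := by
      have : ((x - m) ^ 2) ^ 2 ≤ (2 * (x - s) ^ 2 + 2 * (m - s) ^ 2) ^ 2 := by gcongr
      nlinarith [sq_nonneg ((x - s) ^ 2 - (m - s) ^ 2)]
    have p3 : |x - m| ^ 3 ≤ (T * (x - m) ^ 2 + (1 / T) * (x - m) ^ 4) / 2 := by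
      rw [← sq_abs (x - m), show (x - m) ^ 4 = |x - m| ^ 4 from (by rw [Even.pow_abs (by decide)])]
      set u := |x - m|
      have : (T * u ^ 2 + (1 / T) * u ^ 4) / 2 - u ^ 3 = u ^ 2 * (T - u) ^ 2 / (2 * T) := by
        field_simp; ring
      have : 0 ≤ u ^ 2 * (T - u) ^ 2 / (2 * T) := by positivity
      linarith
    have p4 := mul_le_mul_of_nonneg_left p1 hT.le
    have p5 := mul_le_mul_of_nonneg_left p2 (by positivity : 0 ≤ 1 / T)
    have : (4:ℝ) / T = 4 * (1 / T) := by ring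
    rw [this]
    linarith
  rw [EE_add hβ l (by fun_prop) (by fun_prop), EE_add hβ l (by fun_prop) (by fun_prop), EE_const hβ,
    EE_smul, EE_smul] at hmono
  have r1 := mul_le_mul_of_nonneg_left k2 hT.le
  have r2 := mul_le_mul_of_nonneg_left k4 (by positivity : 0 ≤ 4 / T)
  have r3 := mul_le_mul_of_nonneg_left km hT.le
  have r4 := mul_le_mul_of_nonneg_left km4 (by positivity : 0 ≤ 4 / T)
  have e2 : 4 / T * (11200 * T ^ 4) = 44800 * T ^ 3 := by field_simp; ring
  have e4 : 4 / T * (784 * T ^ 4) = 3136 * T ^ 3 := by field_simp; ring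
  rw [e2] at r2
  rw [e4] at r4
  have : 0 < T ^ 3 := by positivity
  nlinarith

/-- Variance lower bound. -/
lemma var_lower {β : ℝ} (hβ : 0 < β) {l s : ℝ} (hs : 0 < s) (hs1 : s ≤ 1)
    (hl : l * s ^ 2 = β) (hls : 2 ≤ l * s) (hl1 : 1 ≤ l) (hd : dlt β l ≤ s ^ 2 / 4) :
    s ≤ 112 * (l * vpart β l) := by
  have hq2 := q2_bound hβ hs hs1 hl hls
  have hv := vpart_nonneg hβ l
  have h2 := mom_rec hβ l 0
  have h0 : EE β l (fun x => x ^ 0) = 1 := by simpa using EE_one hβ l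
  have e1 : EE β l (fun x => x ^ 1) = mpart β l := by simp [mpart_eq]
  norm_num only [zero_add, h0, e1] at h2
  have hst := stein hβ l (fun x => (hasDerivAt_id x).sub_const (mpart β l)) (by fun_prop)
  have hdn := dlt_nonneg hβ l
  have hmn : 0 ≤ mpart β l := EE_nonneg hβ l (by fun_prop) (fun x h _ => h)
  have hsq := EE_sq hβ l (mpart β l)
  have hve := vpart_eq β l
  set m := mpart β l with hm
  set m2 := EE β l (fun x => x ^ 2)
  simp only [id] at hst
  have e3 : (fun x : ℝ => x ^ 2 * 1 + 2 * x * (x - m)) = fun x => 3 * x ^ 2 - (2 * m) * x := by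
    funext x; ring
  have e4 : (fun x : ℝ => (l * x ^ 2 - β) * (x - m))
      = fun x => l * ((x ^ 2 - s ^ 2) * (x - m)) := by
    funext x; rw [← hl]; ring
  rw [e3, e4, EE_smul, EE_sub hβ l (by fun_prop) (by fun_prop), EE_smul, EE_smul, ← mpart_eq,
    ← hm] at hst
  set K := EE β l (fun x => (x ^ 2 - s ^ 2) * (x - m)) with hK
  set Q := EE β l (fun x => (x ^ 2 - s ^ 2) ^ 2)
  have hm2 : s ^ 2 * (3 / 4) ≤ m2 := by
    have : l * (s ^ 2 * (3 / 4)) ≤ l * m2 := by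
      nlinarith [sq_nonneg s]
    exact le_of_mul_le_mul_left this (by linarith)
  have hlK : s ^ 2 / 2 ≤ l * K := by
    rw [hst]
    nlinarith [mul_nonneg hmn hdn]
  have cs : ∀ t : ℝ, 0 ≤ Q * t ^ 2 - 2 * K * t + vpart β l := by
    intro t
    have : 0 ≤ EE β l (fun x => (t * (x ^ 2 - s ^ 2) - (x - m)) ^ 2) :=
      EE_nonneg hβ l (by fun_prop) (fun x _ _ => sq_nonneg _)
    have e : (fun x : ℝ => (t * (x ^ 2 - s ^ 2) - (x - m)) ^ 2) = fun x =>
      (t ^ 2 * (x ^ 2 - s ^ 2) ^ 2 - (2 * t) * ((x ^ 2 - s ^ 2) * (x - m))) + (x - m) ^ 2 := by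
      funext x; ring
    rw [e, EE_add hβ l (by fun_prop) (by fun_prop), EE_sub hβ l (by fun_prop) (by fun_prop),
      EE_smul, EE_smul, hsq] at this
    nlinarith
  -- choose t = 1/(56 s)
  have ht := cs (1 / (56 * s))
  have h5 : 0 ≤ l * (Q * (1 / (56 * s)) ^ 2 - 2 * K * (1 / (56 * s)) + vpart β l) :=
    mul_nonneg (by linarith) ht
  have h6 : l * Q * (1 / (56 * s)) ^ 2 ≤ 28 * s ^ 3 * (1 / (56 * s)) ^ 2 := by gcongr
  have h7 : (s ^ 2 / 2) * (2 * (1 / (56 * s))) ≤ l * K * (2 * (1 / (56 * s))) := by gcongr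
  have e6 : 28 * s ^ 3 * (1 / (56 * s)) ^ 2 = s / 112 := by field_simp; norm_num
  have e7 : (s ^ 2 / 2) * (2 * (1 / (56 * s))) = s / 56 := by field_simp
  nlinarith

/-- Mean lower bound. -/
lemma mean_lower {β : ℝ} (hβ : 0 < β) {l s θ : ℝ} (hs : 0 < s) (hs1 : s ≤ 1)
    (hl : l * s ^ 2 = β) (hls : 2 ≤ l * s) (hd : dlt β l ≤ s ^ 2 / 4)
    (hθ : θ ^ 2 + 29 / (l * s) ≤ 1) : θ * s ≤ mpart β l := by
  have hl0 : 0 < l := by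
    by_contra hc
    nlinarith
  have hz := z2_bound hβ hs hs1 hl hls
  rw [EE_sq hβ] at hz
  have h2 := mom_rec hβ l 0
  have h0 : EE β l (fun x => x ^ 0) = 1 := by simpa using EE_one hβ l
  have e1 : EE β l (fun x => x ^ 1) = mpart β l := by simp [mpart_eq]
  norm_num only [zero_add, h0, e1] at h2
  have hve := vpart_eq β l
  have hmn : 0 ≤ mpart β l := EE_nonneg hβ l (by fun_prop) (fun x h _ => h)
  set m := mpart β l with hm
  set m2 := EE β l (fun x => x ^ 2)
  have h3 : (l * s ^ 2) * (θ ^ 2 + 29 / (l * s)) ≤ l * s ^ 2 := by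
    have := mul_le_mul_of_nonneg_left hθ (by positivity : 0 ≤ l * s ^ 2)
    linarith
  have e3 : (l * s ^ 2) * (θ ^ 2 + 29 / (l * s)) = l * (θ * s) ^ 2 + 29 * s := by
    field_simp
  have h4 : l * (θ * s) ^ 2 ≤ l * m ^ 2 := by
    have : 0 ≤ l * (m - s) ^ 2 := by positivity
    nlinarith
  have h5 := le_of_mul_le_mul_left h4 hl0
  exact (abs_le_of_sq_le_sq' h5 hmn).2

/-- All asymptotic facts. -/
lemma asymp {β : ℝ} (hβ : 0 < β) (θ : ℝ) (hθ0 : 0 ≤ θ) (hθ : θ < 1) : ∀ᶠ l in atTop, 1 ≤ l ∧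
    Real.sqrt (β / l) ≤ 1 ∧ 2 ≤ l * Real.sqrt (β / l) ∧
    dlt β l ≤ (Real.sqrt (β / l)) ^ 2 / 4 ∧ θ ^ 2 + 29 / (l * Real.sqrt (β / l)) ≤ 1 := by
  have key : ∀ l : ℝ, 0 < l → l * Real.sqrt (β / l) = Real.sqrt (β * l) := by
    intro l hl
    have : Real.sqrt (β * l) = Real.sqrt (l ^ 2 * (β / l)) := by congr 1; field_simp
    rw [this, Real.sqrt_mul (by positivity), Real.sqrt_sq hl.le]
  have tt : Tendsto (fun l : ℝ => Real.sqrt (β * l)) atTop atTop :=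
    Real.tendsto_sqrt_atTop.comp (tendsto_id.const_mul_atTop hβ)
  have texp : Tendsto (fun l : ℝ => 16 * Real.exp (3 * β) * (l * Real.exp (-(1 / 2) * l)))
      atTop (nhds 0) := by
    have := (tendsto_rpow_mul_exp_neg_mul_atTop_nhds_zero 1 (1 / 2) (by norm_num)).const_mul
      (16 * Real.exp (3 * β))
    simpa using this
  have hθ2 : 0 < 1 - θ ^ 2 := by nlinarith
  filter_upwards [eventually_ge_atTop 1, eventually_ge_atTop β,
    tt.eventually_ge_atTop 2, tt.eventually_ge_atTop (29 / (1 - θ ^ 2)),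
    texp.eventually_le_const hβ] with l h1 h2 h3 h4 h5
  have hl0 : 0 < l := by linarith
  refine ⟨h1, ?_, ?_, ?_, ?_⟩
  · rw [Real.sqrt_le_one]
    exact (div_le_one hl0).2 h2
  · rwa [key l hl0]
  · rw [Real.sq_sqrt (by positivity)]
    have hc : (1 / 4) * Real.exp (-(l / 2) - 4 * β) ≤ cpart β l := by
      have hsub : ∫ x in (1/4:ℝ)..(1/2), Real.exp (-(l / 2) - 4 * β) ≤
          ∫ x in (1/4:ℝ)..(1/2), wgt β l x := by
        apply intervalIntegral.integral_mono_on (by norm_num) (by simp)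
        · exact (wgt_int hβ l).mono_set (by
            rw [Set.uIcc_of_le (by norm_num), Set.uIcc_of_le (by norm_num)]
            exact Set.Icc_subset_Icc (by norm_num) (by norm_num))
        · intro x hx
          unfold wgt
          apply Real.exp_le_exp.2
          have hx0 : 0 < x := by linarith [hx.1]
          have : β / x ≤ 4 * β := by
            rw [div_le_iff₀ hx0]; nlinarith [hx.1]
          nlinarith [hx.2]
      have hle : ∫ x in (1/4:ℝ)..(1/2), wgt β l x ≤ ∫ x in (0:ℝ)..1, wgt β l x := by
        apply intervalIntegral.integral_mono_interval (by norm_num) (by norm_num) (by norm_num)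
        · exact Filter.Eventually.of_forall fun x => (wgt_pos _ _ _).le
        · exact wgt_int hβ l
      rw [intervalIntegral.integral_const, smul_eq_mul] at hsub
      have : cpart β l = ∫ x in (0:ℝ)..1, wgt β l x := rfl
      rw [this]
      linarith
    unfold dlt
    rw [div_le_iff₀ (cpart_pos hβ l)]
    have hx : Real.exp (-l - β) =
        Real.exp (3 * β) * Real.exp (-(1/2) * l) * Real.exp (-(l / 2) - 4 * β) := by
      rw [← Real.exp_add, ← Real.exp_add]; congr 1; ring
    have h6 : Real.exp (3 * β) * Real.exp (-(1/2) * l) ≤ β / l / 4 * (1 / 4) := by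
      rw [div_div, div_mul_eq_mul_div, le_div_iff₀ (by positivity)]
      linarith
    calc Real.exp (-l - β) = _ := hx
      _ ≤ β / l / 4 * (1 / 4) * Real.exp (-(l / 2) - 4 * β) := by gcongr
      _ = β / l / 4 * ((1 / 4) * Real.exp (-(l / 2) - 4 * β)) := by ring
      _ ≤ _ := by gcongr
  · rw [key l hl0]
    have : 29 / Real.sqrt (β * l) ≤ 1 - θ ^ 2 := by
      rw [div_le_iff₀ (by linarith)]
      rw [div_le_iff₀ hθ2] at h4
      linarith
    linarith

lemma pack {β : ℝ} (hβ : 0 < β) (θ : ℝ) (hθ0 : 0 ≤ θ) (hθ : θ < 1) : ∃ Λ : ℝ, 1 ≤ Λ ∧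
    ∀ l, Λ ≤ l → mpart β l ≤ 2 * (Real.sqrt β / Real.sqrt l) ∧
      θ * (Real.sqrt β / Real.sqrt l) ≤ mpart β l ∧
      Real.sqrt β / Real.sqrt l ≤ 112 * (l * vpart β l) ∧
      ∀ T, 0 < T → Real.sqrt β / Real.sqrt l ≤ l * T ^ 2 →
        EE β l (fun x => |x - mpart β l| ^ 3) ≤ 100000 * T ^ 3 := by
  obtain ⟨Λ, hΛ⟩ := eventually_atTop.1 (asymp hβ θ hθ0 hθ)
  refine ⟨max Λ 1, le_max_right _ _, fun l hl => ?_⟩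
  obtain ⟨h1, h2, h3, h4, h5⟩ := hΛ l ((le_max_left _ _).trans hl)
  have hl0 : 0 < l := by linarith
  have hs : 0 < Real.sqrt (β / l) := Real.sqrt_pos.2 (by positivity)
  have hls : l * Real.sqrt (β / l) ^ 2 = β := by
    rw [Real.sq_sqrt (by positivity)]; field_simp
  rw [← Real.sqrt_div hβ.le]
  exact ⟨(mom_bounds hβ hs hls h3).1, mean_lower hβ hs h2 hls h3 h4 h5,
    var_lower hβ hs h2 hls h3 h1 h4, fun T hT h => third_bound hβ hs h2 hls h3 hT h⟩

lemma lam_lower {β : ℝ} (hβ : 0 < β) {θ Λ F₁ a f L : ℝ} {N : ℕ} (hθ0 : 0 < θ) (hF₁ : 0 < F₁)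
    (hθ : θ < 1) (hr : 1 < θ ^ 2 * (2 * Real.sqrt β / Real.sqrt F₁))
    (ha : a = F₁ * (1 - θ) ^ 2 / 2)
    (hΛ : ∀ l, Λ ≤ l → θ * (Real.sqrt β / Real.sqrt l) ≤ mpart β l)
    (hN : 1 ≤ N) (hNΛ : Λ ≤ a * (N : ℝ) ^ 2) (hNF : F₁ ≤ a * N) (hf : f ≤ F₁ * N)
    (hsum : ∑ k ∈ Finset.Icc 1 N, mpart β (L + (k : ℝ) * f) = 1) : a * (N : ℝ) ^ 2 ≤ L := by
  by_contra hc
  push Not at hc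
  have hN0 : (0:ℝ) < N := by exact_mod_cast hN
  have ha0 : 0 < a := by
    rw [ha]
    have : 0 < 1 - θ := by linarith
    positivity
  set y : ℕ → ℝ := fun k => Real.sqrt (a * (N : ℝ) ^ 2 + (k : ℝ) * (F₁ * N)) with hy
  have hypos : ∀ k, 0 < y k := fun k => Real.sqrt_pos.2 (by positivity)
  have hysq : ∀ k, y k ^ 2 = a * (N : ℝ) ^ 2 + (k : ℝ) * (F₁ * N) :=
    fun k => Real.sq_sqrt (by positivity)
  have hterm : ∀ k ∈ Finset.Icc 1 N,
      θ * Real.sqrt β * (2 / (F₁ * N)) * (y (k + 1) - y k) ≤ mpart β (L + (k : ℝ) * f) := by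
    intro k _
    have hk0 : (0:ℝ) ≤ k := by positivity
    have h1 : mpart β (a * (N : ℝ) ^ 2 + (k : ℝ) * (F₁ * N)) ≤ mpart β (L + (k : ℝ) * f) := by
      apply mpart_anti hβ
      have := mul_le_mul_of_nonneg_left hf hk0
      linarith
    have h2 := hΛ (a * (N : ℝ) ^ 2 + (k : ℝ) * (F₁ * N)) (by
      have : 0 ≤ (k : ℝ) * (F₁ * N) := by positivity
      linarith)
    have h3 : (2 / (F₁ * N)) * (y (k + 1) - y k) ≤ 1 / y k := by
      rw [le_div_iff₀ (hypos k), div_mul_eq_mul_div, div_mul_eq_mul_div,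
        div_le_one (by positivity)]
      have e1 := hysq k
      have e2 := hysq (k + 1)
      push_cast at e2
      nlinarith [sq_nonneg (y (k + 1) - y k)]
    calc θ * Real.sqrt β * (2 / (F₁ * N)) * (y (k + 1) - y k)
        = θ * Real.sqrt β * ((2 / (F₁ * N)) * (y (k + 1) - y k)) := by ring
      _ ≤ θ * Real.sqrt β * (1 / y k) := by gcongr
      _ = θ * (Real.sqrt β / y k) := by ring
      _ ≤ _ := h2.trans h1
  have hS := Finset.sum_le_sum hterm
  rw [hsum, ← Finset.mul_sum] at hS
  have htel : ∑ k ∈ Finset.Icc 1 N, (y (k + 1) - y k) = y (N + 1) - y 1 := by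
    rw [← Finset.Ico_add_one_right_eq_Icc]
    exact Finset.sum_Ico_sub y (by omega)
  rw [htel] at hS
  set g := Real.sqrt F₁ with hg
  have hg0 : 0 < g := Real.sqrt_pos.2 hF₁
  have hg2 : g ^ 2 = F₁ := Real.sq_sqrt hF₁.le
  have hy1 : y 1 ≤ g * (1 - θ) * N := by
    apply (abs_le_of_sq_le_sq' _ (by have : 0 < 1 - θ := by linarith
                                     positivity)).2
    rw [hysq]
    have : F₁ * N ≤ a * N * N := by gcongr
    have e : (g * (1 - θ) * N) ^ 2 = 2 * a * N ^ 2 := by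
      rw [ha, ← hg2]; ring
    rw [e]; push_cast; nlinarith
  have hyN : g * N ≤ y (N + 1) := by
    apply (abs_le_of_sq_le_sq' _ (hypos _).le).2
    rw [hysq, mul_pow, hg2]
    push_cast
    have : 0 ≤ a * (N:ℝ) ^ 2 := by positivity
    have : 0 ≤ F₁ * (N:ℝ) := by positivity
    nlinarith
  have hfin : θ * Real.sqrt β * (2 / (F₁ * N)) * (g * θ * N) ≤
      θ * Real.sqrt β * (2 / (F₁ * N)) * (y (N + 1) - y 1) := by
    apply mul_le_mul_of_nonneg_left _ (by positivity)
    linarith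
  have e : θ * Real.sqrt β * (2 / (F₁ * N)) * (g * θ * N) = θ ^ 2 * (2 * Real.sqrt β / g) := by
    rw [← hg2]; field_simp
  linarith

lemma lam_upper {β : ℝ} {Λ A f L : ℝ} {N : ℕ} (hβ : 0 < β) (hΛ1 : 1 ≤ Λ)
    (hΛ : ∀ l, Λ ≤ l → mpart β l ≤ 2 * (Real.sqrt β / Real.sqrt l))
    (hA : A = 16 * β + Λ) (hN : 1 ≤ N) (hf : 0 ≤ f)
    (hsum : ∑ k ∈ Finset.Icc 1 N, mpart β (L + (k : ℝ) * f) = 1) : L ≤ A * (N : ℝ) ^ 2 := by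
  by_contra hc
  push Not at hc
  have hN1 : (1:ℝ) ≤ N := by exact_mod_cast hN
  have hterm : ∀ k ∈ Finset.Icc 1 N, mpart β (L + (k : ℝ) * f) ≤ 1 / (2 * N) := by
    intro k _
    have h0 : A * (N : ℝ) ^ 2 ≤ L + (k : ℝ) * f := by
      have : 0 ≤ (k : ℝ) * f := by positivity
      linarith
    have hAΛ : Λ ≤ A * (N : ℝ) ^ 2 := by
      have hN2 : (1:ℝ) ≤ (N : ℝ) ^ 2 := one_le_pow₀ hN1
      have := mul_le_mul_of_nonneg_left hN2 (by linarith : 0 ≤ A)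
      linarith
    refine (hΛ _ (hAΛ.trans h0)).trans ?_
    have h1 : 4 * Real.sqrt β * N ≤ Real.sqrt (L + (k : ℝ) * f) := by
      apply Real.le_sqrt_of_sq_le
      rw [mul_pow, mul_pow, Real.sq_sqrt hβ.le]
      nlinarith
    have hb : 0 < Real.sqrt β := Real.sqrt_pos.2 hβ
    have hp : 0 < 4 * Real.sqrt β * N := by positivity
    calc 2 * (Real.sqrt β / Real.sqrt (L + (k : ℝ) * f))
        ≤ 2 * (Real.sqrt β / (4 * Real.sqrt β * N)) := by gcongr
      _ = 1 / (2 * N) := by field_simp; norm_num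
  have hS := Finset.sum_le_sum hterm
  rw [hsum, Finset.sum_const, Nat.card_Icc, nsmul_eq_mul] at hS
  simp only [Nat.add_sub_cancel] at hS
  have : (N : ℝ) * (1 / (2 * N)) = 1 / 2 := by field_simp
  linarith
/-- Subcritical limit `F(N)/N → F₀ < 4β`: the Lyapunov ratio satisfies `L_N = O(N^{−1/2})`. -/
theorem lyapunov_ratio_bound (β F₀ : ℝ) (hβ : 0 < β)
    (hF₀0 : 0 ≤ F₀) (hF₀ : F₀ < 4 * β)
    (F : ℕ → ℝ) (hF0 : ∀ N, 0 ≤ F N)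
    (hF : Tendsto (fun N : ℕ => F N / N) atTop (nhds F₀))
    (lam : ℕ → ℝ)
    (hlam : ∀ N : ℕ, 2 ≤ N →
      ∑ k ∈ Finset.Icc 1 N, mpart β (lam N + (k : ℝ) * F N) = 1) :
    ∃ C > (0:ℝ), ∃ N₀ : ℕ, ∀ N ≥ N₀,
      (∑ k ∈ Finset.Icc 1 N, (1 / cpart β (lam N + (k : ℝ) * F N)) *
          ∫ x in (0:ℝ)..1, |x - mpart β (lam N + (k : ℝ) * F N)| ^ 3 *
            Real.exp (-((lam N + (k : ℝ) * F N) * x) - β / x)) /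
        (Real.sqrt (∑ k ∈ Finset.Icc 1 N, vpart β (lam N + (k : ℝ) * F N))) ^ 3
      ≤ C / Real.sqrt N := by
  -- choice of constants
  obtain ⟨F₁, hF₁a, hF₁b⟩ := exists_between hF₀
  have hF₁ : 0 < F₁ := by linarith
  set r := 2 * Real.sqrt β / Real.sqrt F₁ with hr
  have hgpos : 0 < Real.sqrt F₁ := Real.sqrt_pos.2 hF₁
  have hbpos : 0 < Real.sqrt β := Real.sqrt_pos.2 hβ
  have hr1 : 1 < r := by
    rw [hr, one_lt_div hgpos]
    have : Real.sqrt F₁ < Real.sqrt (2 ^ 2 * β) := Real.sqrt_lt_sqrt hF₁.le (by linarith)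
    rwa [Real.sqrt_mul (by norm_num), Real.sqrt_sq (by norm_num)] at this
  have hrinv : 1 / r < 1 := by rw [div_lt_one (by linarith)]; exact hr1
  have hrinv0 : 0 < 1 / r := by positivity
  set θ := Real.sqrt ((1 + 1 / r) / 2) with hθ
  have hθ2 : θ ^ 2 = (1 + 1 / r) / 2 := Real.sq_sqrt (by linarith)
  have hθ0 : 0 < θ := Real.sqrt_pos.2 (by linarith)
  have hθ1 : θ < 1 := by nlinarith
  have hθr : 1 < θ ^ 2 * r := by
    rw [hθ2]
    have : 1 / r * r = 1 := by field_simp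
    nlinarith
  obtain ⟨Λ, hΛ1, hΛ⟩ := pack hβ θ hθ0.le hθ1
  obtain ⟨a, ha⟩ : ∃ a, a = F₁ * (1 - θ) ^ 2 / 2 := ⟨_, rfl⟩
  have ha0 : 0 < a := by
    rw [ha]
    have : 0 < 1 - θ := by linarith
    positivity
  obtain ⟨A, hA⟩ : ∃ A, A = 16 * β + Λ := ⟨_, rfl⟩
  have hA0 : 0 < A := by linarith
  obtain ⟨B, hB⟩ : ∃ B, B = A + F₁ := ⟨_, rfl⟩
  have hB0 : 0 < B := by linarith
  obtain ⟨c, hc⟩ : ∃ c, c = Real.sqrt β / (112 * B * Real.sqrt B) := ⟨_, rfl⟩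
  have hsB : 0 < Real.sqrt B := Real.sqrt_pos.2 hB0
  have hsa : 0 < Real.sqrt a := Real.sqrt_pos.2 ha0
  have hc0 : 0 < c := by rw [hc]; positivity
  obtain ⟨τ, hτ⟩ : ∃ τ, τ = Real.sqrt (Real.sqrt β / (a * Real.sqrt a)) := ⟨_, rfl⟩
  have hτ0 : 0 < τ := by rw [hτ]; exact Real.sqrt_pos.2 (by positivity)
  have hτ2 : τ ^ 2 = Real.sqrt β / (a * Real.sqrt a) := by
    rw [hτ]; exact Real.sq_sqrt (by positivity)
  have hsc : 0 < Real.sqrt c := Real.sqrt_pos.2 hc0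
  have tN : Tendsto (fun N : ℕ => (N : ℝ)) atTop atTop := tendsto_natCast_atTop_atTop
  have ev : ∀ᶠ N : ℕ in atTop, F N / N ≤ F₁ := hF.eventually_le_const hF₁a
  obtain ⟨N₀, hN₀⟩ := eventually_atTop.1 (ev.and ((eventually_ge_atTop 2).and
    ((tN.eventually_ge_atTop (Λ / a)).and (tN.eventually_ge_atTop (F₁ / a)))))
  refine ⟨100000 * τ ^ 3 / Real.sqrt c ^ 3, by positivity, N₀, fun N hN => ?_⟩
  obtain ⟨g1, g2, g3, g4⟩ := hN₀ N hN
  have hN1 : (1:ℝ) ≤ N := by exact_mod_cast (by omega : 1 ≤ N)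
  have hN0 : (0:ℝ) < N := by linarith
  rw [div_le_iff₀ hN0] at g1
  rw [div_le_iff₀ ha0] at g3 g4
  have hNΛ : Λ ≤ a * (N : ℝ) ^ 2 := by nlinarith
  have hlow := lam_lower hβ hθ0 hF₁ hθ1 hθr ha (fun l hl => (hΛ l hl).2.1) (by omega) hNΛ
    (by linarith) g1 (hlam N g2)
  have hup := lam_upper hβ hΛ1 (fun l hl => (hΛ l hl).1) hA (by omega) (hF0 N) (hlam N g2)
  obtain ⟨n, hn⟩ : ∃ n, n = Real.sqrt N := ⟨_, rfl⟩
  have hn0 : 0 < n := by rw [hn]; exact Real.sqrt_pos.2 hN0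
  have hn2 : (N : ℝ) = n ^ 2 := by rw [hn, Real.sq_sqrt hN0.le]
  have hlk : ∀ k ∈ Finset.Icc 1 N, a * (N : ℝ) ^ 2 ≤ lam N + (k : ℝ) * F N ∧
      lam N + (k : ℝ) * F N ≤ B * (N : ℝ) ^ 2 := by
    intro k hk
    have hk2 : (k : ℝ) ≤ N := by exact_mod_cast (Finset.mem_Icc.1 hk).2
    have h1 : 0 ≤ (k : ℝ) * F N := mul_nonneg (by positivity) (hF0 N)
    have h2 : (k : ℝ) * F N ≤ N * (F₁ * N) := mul_le_mul hk2 g1 (hF0 N) hN0.le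
    constructor
    · linarith
    · rw [hB]; nlinarith
  have hthird : ∑ k ∈ Finset.Icc 1 N, (1 / cpart β (lam N + (k : ℝ) * F N)) *
          ∫ x in (0:ℝ)..1, |x - mpart β (lam N + (k : ℝ) * F N)| ^ 3 *
            Real.exp (-((lam N + (k : ℝ) * F N) * x) - β / x)
      ≤ n ^ 2 * (100000 * (τ / n ^ 3) ^ 3) := by
    have hterm : ∀ k ∈ Finset.Icc 1 N, (1 / cpart β (lam N + (k : ℝ) * F N)) *
          (∫ x in (0:ℝ)..1, |x - mpart β (lam N + (k : ℝ) * F N)| ^ 3 *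
            Real.exp (-((lam N + (k : ℝ) * F N) * x) - β / x))
        ≤ 100000 * (τ / n ^ 3) ^ 3 := by
      intro k hk
      obtain ⟨h1, -⟩ := hlk k hk
      set l := lam N + (k : ℝ) * F N
      have hl0 : 0 < l := by linarith
      have hsl : Real.sqrt a * N ≤ Real.sqrt l := by
        apply Real.le_sqrt_of_sq_le
        rw [mul_pow, Real.sq_sqrt ha0.le]
        exact h1
      have h3 := (hΛ l (hNΛ.trans h1)).2.2.2 (τ / n ^ 3) (by positivity) (by
        rw [div_le_iff₀ (Real.sqrt_pos.2 hl0)]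
        calc Real.sqrt β = (a * (N : ℝ) ^ 2) * (τ / n ^ 3) ^ 2 * (Real.sqrt a * N) := by
              rw [div_pow, hτ2, hn2]; field_simp
          _ ≤ _ := by gcongr)
      calc _ = EE β l (fun x => |x - mpart β l| ^ 3) := by
            rw [one_div_mul_eq_div]; rfl
        _ ≤ _ := h3
    refine (Finset.sum_le_sum hterm).trans (le_of_eq ?_)
    rw [Finset.sum_const, Nat.card_Icc, nsmul_eq_mul, Nat.add_sub_cancel, hn2]
  have hvar : c / n ^ 4 ≤ ∑ k ∈ Finset.Icc 1 N, vpart β (lam N + (k : ℝ) * F N) := by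
    have hterm : ∀ k ∈ Finset.Icc 1 N, c / n ^ 6 ≤ vpart β (lam N + (k : ℝ) * F N) := by
      intro k hk
      obtain ⟨h1, h2⟩ := hlk k hk
      set l := lam N + (k : ℝ) * F N
      have hl0 : 0 < l := by linarith
      have hsl : Real.sqrt l ≤ Real.sqrt B * N := by
        apply (Real.sqrt_le_sqrt h2).trans
        rw [Real.sqrt_mul hB0.le, Real.sqrt_sq hN0.le]
      have h3 := (hΛ l (hNΛ.trans h1)).2.2.1
      have hslp := Real.sqrt_pos.2 hl0
      rw [div_le_iff₀ hslp] at h3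
      have hv := vpart_nonneg hβ l
      have h4 : 112 * (l * vpart β l) * Real.sqrt l ≤
          112 * (B * (N : ℝ) ^ 2 * vpart β l) * (Real.sqrt B * N) := by gcongr
      rw [hc, div_div, div_le_iff₀ (by positivity)]
      calc Real.sqrt β ≤ _ := h3.trans h4
        _ = _ := by rw [hn2]; ring
    refine le_trans (le_of_eq ?_) (Finset.sum_le_sum hterm)
    rw [Finset.sum_const, Nat.card_Icc, nsmul_eq_mul, Nat.add_sub_cancel, hn2]
    field_simp
  have hsig : Real.sqrt c / n ^ 2 ≤
      Real.sqrt (∑ k ∈ Finset.Icc 1 N, vpart β (lam N + (k : ℝ) * F N)) := by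
    apply Real.le_sqrt_of_sq_le
    rw [div_pow, Real.sq_sqrt hc0.le, ← pow_mul]
    exact hvar
  rw [← hn]
  calc _ ≤ n ^ 2 * (100000 * (τ / n ^ 3) ^ 3) / (Real.sqrt c / n ^ 2) ^ 3 := by
        gcongr
    _ = _ := by field_simp
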